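/- arXiv:2003.03854 — 4 statements merged into one kernel-verified Lean document; each statement's English description precedes it below -/
import Mathlib

section
/- If h : D → ℝ is a smooth function vanishing at every point of M, then there exist smooth functions h¹, …, h^k : D → ℝ such that h(x) = Σ_{a=1}^k h^a(x) f^a(x) for all x ∈ D. -/
open scoped BigOperators

noncomputable section

/-- `∂ᵢ h`, the `i`-th partial derivative of `h : ℝⁿ → ℝ`. -/
def pd {n : ℕ} (h : (Fin n → ℝ) → ℝ) (i : Fin n) (x : Fin n → ℝ) : ℝ :=
  fderiv ℝ h x (Pi.single i 1)

/-- The action `X(h) = Σᵢ Xⁱ ∂ᵢ h` of a vector field on a function. -/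
def vact {n : ℕ} (X : (Fin n → ℝ) → Fin n → ℝ) (h : (Fin n → ℝ) → ℝ)
    (x : Fin n → ℝ) : ℝ :=
  ∑ i, X x i * pd h i x

/-- The Lie bracket `[X,Y]ʲ = Σᵢ (Xⁱ ∂ᵢYʲ − Yⁱ ∂ᵢXʲ)` of vector fields. -/
def lie {n : ℕ} (X Y : (Fin n → ℝ) → Fin n → ℝ) (x : Fin n → ℝ) : Fin n → ℝ :=
  fun j => ∑ i, (X x i * pd (fun y => Y y j) i x - Y x i * pd (fun y => X y j) i x)

open scoped ContDiff Manifold Topology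

/-- Smoothness of a parametric integral over the unit interval. -/
theorem aux_param {E : Type} [NormedAddCommGroup E] [NormedSpace ℝ E]
    (F : E → ℝ → ℝ) (hF : ContDiff ℝ (⊤ : ℕ∞) (fun q : E × ℝ => F q.1 q.2)) :
    ContDiff ℝ (⊤ : ℕ∞) (fun x => ∫ t in (0 : ℝ)..1, F x t) := by
  let χ : ContDiffBump (0 : ℝ) := ⟨2, 3, by norm_num, by norm_num⟩
  have key := MeasureTheory.contDiffOn_convolution_right_with_param_comp (𝕜 := ℝ) (n := ⊤)
    (μ := MeasureTheory.volume.restrict (Set.Ioc (0 : ℝ) 1))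
    (ContinuousLinearMap.mul ℝ ℝ) (s := (Set.univ : Set E)) (v := fun _ => (0 : ℝ))
    contDiffOn_const (f := fun _ => (1 : ℝ)) (g := fun x t => χ t * F x (-t))
    (k := Metric.closedBall (0 : ℝ) 3) isOpen_univ (isCompact_closedBall _ _)
    (by
      intro p x _ hx
      have : χ x = 0 := χ.zero_of_le_dist (by
        simp only [Metric.mem_closedBall, not_le] at hx
        exact hx.le)
      simp [this])
    (MeasureTheory.locallyIntegrable_const _)
    (by
      apply ContDiff.contDiffOn
      have h1 : ContDiff ℝ (⊤ : ℕ∞) (fun q : E × ℝ => χ q.2) := χ.contDiff.comp contDiff_snd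
      have h2 : ContDiff ℝ (⊤ : ℕ∞) (fun q : E × ℝ => F q.1 (-q.2)) :=
        hF.comp (contDiff_fst.prodMk contDiff_snd.neg)
      exact h1.mul h2)
  rw [contDiffOn_univ] at key
  convert key using 2 with x
  rw [MeasureTheory.convolution_def, intervalIntegral.integral_of_le zero_le_one]
  apply MeasureTheory.setIntegral_congr_fun measurableSet_Ioc
  intro t ht
  have : χ (0 - t) = 1 := χ.one_of_mem_closedBall (by
    simp only [Metric.mem_closedBall, dist_zero_right, Real.norm_eq_abs]
    change |0 - t| ≤ 2
    rw [abs_le]; constructor <;> linarith [ht.1, ht.2])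
  simp only [ContinuousLinearMap.mul_apply', one_mul, this]
  simp

/-- Linear version of Hadamard's lemma. -/
theorem aux_hadamard {E : Type} [NormedAddCommGroup E] [NormedSpace ℝ E] {k : ℕ}
    (L : E →L[ℝ] (Fin k → ℝ)) (s : (Fin k → ℝ) →L[ℝ] E)
    (hs : ∀ u, L (s u) = u) (g : E → ℝ) (hg : ContDiff ℝ (⊤ : ℕ∞) g)
    (h0 : ∀ y, L y = 0 → g y = 0) :
    ∃ c : E → Fin k → ℝ, ContDiff ℝ (⊤ : ℕ∞) c ∧ ∀ y, g y = ∑ a, c y a * L y a := by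
  let γ : E → ℝ → E := fun y t => (y - s (L y)) + t • s (L y)
  have hγ : ContDiff ℝ (⊤ : ℕ∞) (fun q : E × ℝ => γ q.1 q.2) := by
    simp only [γ]; fun_prop
  have hdg : ContDiff ℝ (⊤ : ℕ∞) (fun y => fderiv ℝ g y) :=
    hg.fderiv_right (by simp)
  have hDγ : ContDiff ℝ (⊤ : ℕ∞) (fun q : E × ℝ => fderiv ℝ g (γ q.1 q.2)) := hdg.comp hγ
  refine ⟨fun y a => ∫ t in (0 : ℝ)..1, fderiv ℝ g (γ y t) (s (Pi.single a 1)), ?_, ?_⟩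
  · rw [contDiff_pi]
    intro a
    exact aux_param (fun y t => fderiv ℝ g (γ y t) (s (Pi.single a 1)))
      (hDγ.clm_apply contDiff_const)
  · intro y
    have hcont : ∀ v, Continuous (fun t : ℝ => fderiv ℝ g (γ y t) v) := by
      intro v
      have : Continuous (fun t : ℝ => fderiv ℝ g (γ y t)) :=
        hDγ.continuous.comp (Continuous.prodMk_right y)
      exact this.clm_apply continuous_const
    have hder : ∀ t ∈ Set.uIcc (0 : ℝ) 1,
        HasDerivAt (fun t => g (γ y t)) (fderiv ℝ g (γ y t) (s (L y))) t := by
      intro t _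
      have h1 : HasDerivAt (γ y) (s (L y)) t := by
        have h2 := ((hasDerivAt_id t).smul_const (s (L y))).const_add (y - s (L y))
        rw [one_smul] at h2
        exact h2
      exact ((hg.differentiable (by simp)) _).hasFDerivAt.comp_hasDerivAt t h1
    have hint := intervalIntegral.integral_eq_sub_of_hasDerivAt hder
      ((hcont _).intervalIntegrable _ _)
    have e1 : γ y 1 = y := by simp [γ]
    have e0 : g (γ y 0) = 0 := h0 _ (by simp [γ, hs])
    rw [e1, e0, sub_zero] at hint
    rw [← hint]
    have hsum : s (L y) = ∑ a, L y a • s (Pi.single a 1) := by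
      conv_lhs => rw [pi_eq_sum_univ' (L y)]
      rw [map_sum]
      refine Finset.sum_congr rfl fun a _ => ?_
      rw [← map_smul]
    simp_rw [← intervalIntegral.integral_mul_const]
    rw [← intervalIntegral.integral_finsetSum]
    · refine intervalIntegral.integral_congr fun t _ => ?_
      rw [hsum, map_sum]
      refine Finset.sum_congr rfl fun a _ => ?_
      rw [map_smul, smul_eq_mul, mul_comm]
    · intro a _
      exact ((hcont _).mul continuous_const).intervalIntegrable _ _

/-- Local decomposition near a zero of `f`. -/
theorem aux_local {E : Type} [NormedAddCommGroup E] [NormedSpace ℝ E] [FiniteDimensional ℝ E]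
    {k : ℕ} (D : Set E) (hD : IsOpen D) (f : E → Fin k → ℝ) (hf : ContDiffOn ℝ (⊤ : ℕ∞) f D)
    (h : E → ℝ) (hh : ContDiffOn ℝ (⊤ : ℕ∞) h D)
    (hM : ∀ x ∈ D, f x = 0 → h x = 0) (x₀ : E) (hx₀ : x₀ ∈ D)
    (hsurj : Function.Surjective (fderiv ℝ f x₀)) :
    ∃ U ∈ 𝓝 x₀, ∃ c : E → Fin k → ℝ, ContDiffOn ℝ (⊤ : ℕ∞) c U ∧
      ∀ x ∈ U, h x = ∑ a, c x a * f x a := by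
  have : CompleteSpace E := FiniteDimensional.complete ℝ E
  set L := fderiv ℝ f x₀ with hL
  obtain ⟨s, hs⟩ := L.exists_rightInverse_of_surjective (LinearMap.range_eq_top.2 hsurj)
  replace hs : ∀ u, L (s u) = u := fun u => DFunLike.congr_fun hs u
  let Ψ : E → E := fun x => x + s (f x - L x)
  have hLΨ : ∀ x, L (Ψ x) = f x := by intro x; simp [Ψ, hs]
  have hfat : ∀ x ∈ D, ContDiffAt ℝ (⊤ : ℕ∞) f x := fun x hx => hf.contDiffAt (hD.mem_nhds hx)
  have hΨ : ∀ x ∈ D, ContDiffAt ℝ (⊤ : ℕ∞) Ψ x := by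
    intro x hx
    have := hfat x hx
    simp only [Ψ]
    fun_prop
  have hΨ' : HasFDerivAt Ψ ((ContinuousLinearEquiv.refl ℝ E : E ≃L[ℝ] E) : E →L[ℝ] E) x₀ := by
    have h1 : HasFDerivAt f L x₀ := ((hfat x₀ hx₀).differentiableAt (by simp)).hasFDerivAt
    have h2 := (hasFDerivAt_id x₀).add (s.hasFDerivAt.comp x₀ (h1.sub L.hasFDerivAt))
    convert! h2 using 1
    ext v; simp
  let e := (hΨ x₀ hx₀).toOpenPartialHomeomorph Ψ hΨ' (by simp)
  have he : ∀ x, e x = Ψ x := fun x => rfl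
  have hx₀e : x₀ ∈ e.source := (hΨ x₀ hx₀).mem_toOpenPartialHomeomorph_source hΨ' (by simp)
  have hinv : ∀ᶠ x in 𝓝 x₀, fderiv ℝ Ψ x ∈ Set.range ((↑) : (E ≃L[ℝ] E) → E →L[ℝ] E) := by
    have hc : ContinuousAt (fderiv ℝ Ψ) x₀ :=
      ((hΨ x₀ hx₀).fderiv_right (m := 0) (by simp)).continuousAt
    apply hc
    rw [hΨ'.fderiv]
    exact ContinuousLinearEquiv.nhds _
  obtain ⟨V, hVsub, hVo, hx₀V⟩ := mem_nhds_iff.1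
    (Filter.inter_mem hinv (hD.mem_nhds hx₀))
  let W : Set E := e.target ∩ e.symm ⁻¹' V
  have hWo : IsOpen W := e.symm.isOpen_inter_preimage hVo
  have hy₀ : Ψ x₀ ∈ W := by
    refine ⟨e.map_source hx₀e, ?_⟩
    change e.symm (e x₀) ∈ V
    rwa [e.left_inv hx₀e]
  have hsymm : ∀ y ∈ W, ContDiffAt ℝ (⊤ : ℕ∞) e.symm y := by
    intro y hy
    obtain ⟨⟨A, hA⟩, hyD⟩ := hVsub hy.2
    have hc := hΨ _ hyD
    refine e.contDiffAt_symm (f₀' := A) hy.1 ?_ hc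
    rw [hA]
    exact (hc.differentiableAt (by simp)).hasFDerivAt
  have hcomp : ∀ y ∈ W, ContDiffAt ℝ (⊤ : ℕ∞) (fun y => h (e.symm y)) y := by
    intro y hy
    exact (hh.contDiffAt (hD.mem_nhds (hVsub hy.2).2)).comp y (hsymm y hy)
  obtain ⟨r, hr, hrW⟩ := Metric.isOpen_iff.1 hWo _ hy₀
  let χ : ContDiffBump (Ψ x₀) := ⟨r / 4, r / 2, by positivity, by linarith⟩
  have hχ0 : ∀ y, y ∉ Metric.closedBall (Ψ x₀) (r / 2) → χ y = 0 := by
    intro y hy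
    apply χ.zero_of_le_dist
    simp only [Metric.mem_closedBall, not_le] at hy
    exact hy.le
  have hsub : Metric.closedBall (Ψ x₀) (r / 2) ⊆ W :=
    (Metric.closedBall_subset_ball (by linarith)).trans hrW
  have hg : ContDiff ℝ (⊤ : ℕ∞) (fun y => χ y * h (e.symm y)) := by
    rw [contDiff_iff_contDiffAt]
    intro y
    by_cases hy : y ∈ Metric.closedBall (Ψ x₀) (r / 2)
    · exact χ.contDiff.contDiffAt.mul (hcomp y (hsub hy))
    · have : (fun y => χ y * h (e.symm y)) =ᶠ[𝓝 y] fun _ => 0 := by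
        filter_upwards [Metric.isClosed_closedBall.isOpen_compl.mem_nhds hy] with z hz
        simp [hχ0 z hz]
      exact contDiffAt_const.congr_of_eventuallyEq this
  obtain ⟨c, hc, hceq⟩ := aux_hadamard L s hs _ hg (by
    intro y hy
    by_cases hyb : y ∈ Metric.closedBall (Ψ x₀) (r / 2)
    · have hyW := hsub hyb
      have : f (e.symm y) = 0 := by
        rw [← hLΨ, ← he, e.right_inv hyW.1, hy]
      simp [hM _ (hVsub hyW.2).2 this]
    · simp [hχ0 y hyb])
  have hΨc : ContinuousAt Ψ x₀ := (hΨ x₀ hx₀).continuousAt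
  refine ⟨D ∩ e.source ∩ Ψ ⁻¹' Metric.closedBall (Ψ x₀) (r / 4), ?_, fun x => c (Ψ x), ?_, ?_⟩
  · exact Filter.inter_mem (Filter.inter_mem (hD.mem_nhds hx₀) (e.open_source.mem_nhds hx₀e))
      (hΨc (Metric.closedBall_mem_nhds _ (by positivity)))
  · intro x hx
    exact (hc.contDiffAt.comp x (hΨ x hx.1.1)).contDiffWithinAt
  · intro x hx
    have h1 := hceq (Ψ x)
    have h2 : χ (Ψ x) = 1 := χ.one_of_mem_closedBall hx.2
    have h3 : e.symm (Ψ x) = x := e.left_inv hx.1.2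
    simp only [h2, h3, hLΨ, one_mul] at h1
    exact h1

/-- Full rank of the Jacobian gives surjectivity of the derivative. -/
theorem aux_surj {n k : ℕ} (f : (Fin n → ℝ) → Fin k → ℝ) (x : Fin n → ℝ)
    (hf : DifferentiableAt ℝ f x)
    (hr : (Matrix.of fun (a : Fin k) (i : Fin n) => pd (fun y => f y a) i x).rank = k) :
    Function.Surjective (fderiv ℝ f x) := by
  set A := Matrix.of fun (a : Fin k) (i : Fin n) => pd (fun y => f y a) i x with hA
  have heq : ∀ v, A.mulVecLin v = fderiv ℝ f x v := by
    have : A.mulVecLin = (fderiv ℝ f x : (Fin n → ℝ) →ₗ[ℝ] (Fin k → ℝ)) := by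
      apply LinearMap.pi_ext'
      intro i
      ext a
      have h1 : fderiv ℝ (fun y => f y a) x = (ContinuousLinearMap.proj a).comp (fderiv ℝ f x) :=
        (hasFDerivAt_pi'.1 hf.hasFDerivAt a).fderiv
      simp [hA, pd, h1]
    intro v; rw [this]; rfl
  have hsurj : Function.Surjective A.mulVecLin := by
    rw [← LinearMap.range_eq_top]
    apply Submodule.eq_top_of_finrank_eq
    rw [← Matrix.rank.eq_1, hr]; simp
  intro u
  obtain ⟨v, hv⟩ := hsurj u
  exact ⟨v, by rw [← heq, hv]⟩

/-- **Decomposition of the vanishing ideal** (Theorem 1 of the paper).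
If `h` is smooth on the open set `D ⊆ ℝⁿ` and vanishes at every point of
`M = {x ∈ D | f x = 0}`, where `f : D → ℝᵏ` is smooth with Jacobian of rank `k`
everywhere on `D` (and `0 < k < n`), then there are smooth functions
`h¹, …, hᵏ` on `D` with `h = Σ_a hᵃ fᵃ` on `D`. -/
theorem statement0 {n k : ℕ} (hk : 0 < k) (hkn : k < n)
    (D : Set (Fin n → ℝ)) (hD : IsOpen D)
    (f : (Fin n → ℝ) → Fin k → ℝ) (hf : ContDiffOn ℝ (⊤ : ℕ∞) f D)
    (hrank : ∀ x ∈ D,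
      (Matrix.of fun (a : Fin k) (i : Fin n) => pd (fun y => f y a) i x).rank = k)
    (h : (Fin n → ℝ) → ℝ) (hh : ContDiffOn ℝ (⊤ : ℕ∞) h D)
    (hM : ∀ x ∈ D, f x = 0 → h x = 0) :
    ∃ c : Fin k → (Fin n → ℝ) → ℝ,
      (∀ a, ContDiffOn ℝ (⊤ : ℕ∞) (c a) D) ∧
      ∀ x ∈ D, h x = ∑ a, c a x * f x a := by
  have hloc : ∀ x₀ ∈ D, ∃ U ∈ 𝓝 x₀, ∃ c : (Fin n → ℝ) → Fin k → ℝ,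
      ContDiffOn ℝ (⊤ : ℕ∞) c U ∧ ∀ x ∈ U, h x = ∑ a, c x a * f x a := fun x₀ hx₀ =>
    aux_local D hD f hf h hh hM x₀ hx₀ (aux_surj f x₀
      ((hf.contDiffAt (hD.mem_nhds hx₀)).differentiableAt (by simp)) (hrank x₀ hx₀))
  let D' : TopologicalSpace.Opens (Fin n → ℝ) := ⟨D, hD⟩
  have : SigmaCompactSpace D' := by
    have : LocallyCompactSpace D' := hD.locallyCompactSpace
    infer_instance
  obtain ⟨g, hg⟩ := exists_contMDiffMap_forall_mem_convex_of_local (M := D') (n := (⊤ : ℕ∞))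
    𝓘(ℝ, Fin n → ℝ) (F := Fin k → ℝ)
    (t := fun x => {c | h x = ∑ a, c a * f x a})
    (by
      intro x c hc d hd p q hp hq hpq
      simp only [Set.mem_ofPred_eq] at hc hd ⊢
      simp only [Pi.add_apply, Pi.smul_apply, smul_eq_mul, add_mul, Finset.sum_add_distrib,
        mul_assoc, ← Finset.mul_sum, ← hc, ← hd]
      rw [← add_mul, hpq, one_mul])
    (by
      intro x
      obtain ⟨U, hU, c, hc, hceq⟩ := hloc x.1 x.2
      refine ⟨Subtype.val ⁻¹' interior U,
        (isOpen_interior.preimage continuous_subtype_val).mem_nhds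
          (mem_interior_iff_mem_nhds.2 hU), fun y => c y, ?_, ?_⟩
      · intro y hy
        have h1 : ContDiffAt ℝ (⊤ : ℕ∞) c y.1 :=
          hc.contDiffAt (mem_interior_iff_mem_nhds.1 hy)
        exact (contMDiffAt_subtype_iff.2 h1.contMDiffAt).contMDiffWithinAt
      · intro y hy
        exact hceq _ (interior_subset hy))
  classical
  let G : (Fin n → ℝ) → Fin k → ℝ := fun x => if hx : x ∈ D then g ⟨x, hx⟩ else 0
  have hGg : (fun x : D' => G x) = g := by
    funext x
    have hx : (x : Fin n → ℝ) ∈ D := x.2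
    simp [G, hx]
  have hG : ∀ x ∈ D, ContDiffAt ℝ (⊤ : ℕ∞) G x := by
    intro x hx
    have h1 : ContMDiffAt 𝓘(ℝ, Fin n → ℝ) 𝓘(ℝ, Fin k → ℝ) (⊤ : ℕ∞)
        (fun x : D' => G x) (⟨x, hx⟩ : D') := by
      rw [hGg]; exact g.contMDiff _
    exact (contMDiffAt_subtype_iff.1 h1).contDiffAt
  refine ⟨fun a x => G x a, ?_, ?_⟩
  · intro a x hx
    exact (contDiffAt_pi.1 (hG x hx) a).contDiffWithinAt
  · intro x hx
    have := hg ⟨x, hx⟩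
    simpa [G, hx] using this
end
end

section
/- For a smooth 1-form ω on D the following are equivalent: (i) ⟨X, ω⟩ = 0 identically on D for every tangent vector field X; (ii) there exist smooth functions ω_1, …, ω_k : D → ℝ with ω = Σ_{a=1}^k ω_a df^a, i.e. ω_i = Σ_a ω_a ∂_i f^a on D. -/
open scoped BigOperators

noncomputable section

theorem aux_det {n k : ℕ} {D : Set (Fin n → ℝ)} (M : (Fin n → ℝ) → Matrix (Fin k) (Fin k) ℝ)
    (hM : ∀ a b, ContDiffOn ℝ (⊤ : ℕ∞) (fun x => M x a b) D) :
    ContDiffOn ℝ (⊤ : ℕ∞) (fun x => (M x).det) D := by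
  simp only [Matrix.det_apply']
  refine ContDiffOn.sum fun σ _ => ?_
  exact contDiffOn_const.mul (contDiffOn_prod fun i _ => hM _ _)

theorem aux_adj {n k : ℕ} {D : Set (Fin n → ℝ)} (M : (Fin n → ℝ) → Matrix (Fin k) (Fin k) ℝ)
    (hM : ∀ a b, ContDiffOn ℝ (⊤ : ℕ∞) (fun x => M x a b) D) (a b : Fin k) :
    ContDiffOn ℝ (⊤ : ℕ∞) (fun x => (M x).adjugate a b) D := by
  simp only [Matrix.adjugate_apply]
  refine aux_det _ fun i j => ?_
  by_cases h : i = b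
  · subst h
    simp only [Matrix.updateRow_self]
    exact contDiffOn_const
  · simp only [Matrix.updateRow_ne h]
    exact hM i j

theorem aux_unit {n k : ℕ} (J : Matrix (Fin k) (Fin n) ℝ) (h : J.rank = k) :
    IsUnit (J * J.transpose).det := by
  rw [← Matrix.isUnit_iff_isUnit_det, ← Matrix.linearIndependent_rows_iff_isUnit,
    linearIndependent_iff_card_eq_finrank_span, Set.finrank, ← Matrix.rank_eq_finrank_span_row,
    Matrix.rank_self_mul_transpose, h, Fintype.card_fin]

theorem aux_pd {n k : ℕ} {D : Set (Fin n → ℝ)} (hD : IsOpen D)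
    (f : (Fin n → ℝ) → Fin k → ℝ) (hf : ContDiffOn ℝ (⊤ : ℕ∞) f D) (a : Fin k) (i : Fin n) :
    ContDiffOn ℝ (⊤ : ℕ∞) (fun x => pd (fun y => f y a) i x) D := by
  have h1 := contDiffOn_pi.1 hf a
  have h2 : ContDiffOn ℝ (⊤ : ℕ∞) (fderiv ℝ (fun y => f y a)) D :=
    h1.fderiv_of_isOpen hD (by exact_mod_cast le_top)
  exact h2.clm_apply contDiffOn_const

/-- For a smooth 1-form `ω` on `D` the following are equivalent:
(i) `⟨X, ω⟩ = 0` on `D` for every tangent vector field `X`;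
(ii) `ω = Σ_a ω_a dfᵃ` on `D` with smooth functions `ω_a`. -/
theorem statement2 {n k : ℕ} (hk : 0 < k) (hkn : k < n)
    (D : Set (Fin n → ℝ)) (hD : IsOpen D)
    (f : (Fin n → ℝ) → Fin k → ℝ) (hf : ContDiffOn ℝ (⊤ : ℕ∞) f D)
    (hrank : ∀ x ∈ D,
      (Matrix.of fun (a : Fin k) (i : Fin n) => pd (fun y => f y a) i x).rank = k)
    (ω : (Fin n → ℝ) → Fin n → ℝ) (hω : ContDiffOn ℝ (⊤ : ℕ∞) ω D) :
    (∀ X : (Fin n → ℝ) → Fin n → ℝ, ContDiffOn ℝ (⊤ : ℕ∞) X D →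
        (∀ a, ∀ x ∈ D, vact X (fun y => f y a) x = 0) →
        ∀ x ∈ D, ∑ i, X x i * ω x i = 0) ↔
    (∃ c : Fin k → (Fin n → ℝ) → ℝ,
        (∀ a, ContDiffOn ℝ (⊤ : ℕ∞) (c a) D) ∧
        ∀ x ∈ D, ∀ i, ω x i = ∑ a, c a x * pd (fun y => f y a) i x) := by
  constructor
  · intro h
    set J : (Fin n → ℝ) → Matrix (Fin k) (Fin n) ℝ := fun x =>
      Matrix.of fun (a : Fin k) (i : Fin n) => pd (fun y => f y a) i x with hJ
    have hJs : ∀ a i, ContDiffOn ℝ (⊤ : ℕ∞) (fun x => J x a i) D := fun a i =>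
      aux_pd hD f hf a i
    have hωs : ∀ i, ContDiffOn ℝ (⊤ : ℕ∞) (fun x => ω x i) D := fun i => contDiffOn_pi.1 hω i
    have hG : ∀ a b, ContDiffOn ℝ (⊤ : ℕ∞) (fun x => (J x * (J x).transpose) a b) D := by
      intro a b
      simp only [Matrix.mul_apply, Matrix.transpose_apply]
      exact ContDiffOn.sum fun i _ => (hJs a i).mul (hJs b i)
    have hunit : ∀ x ∈ D, IsUnit (J x * (J x).transpose).det := fun x hx =>
      aux_unit _ (hrank x hx)
    have hGi : ∀ a b, ContDiffOn ℝ (⊤ : ℕ∞) (fun x => (J x * (J x).transpose)⁻¹ a b) D := by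
      intro a b
      simp only [Matrix.inv_def, Ring.inverse_eq_inv', Matrix.smul_apply, smul_eq_mul]
      exact ((aux_det _ hG).inv fun x hx => (hunit x hx).ne_zero).mul (aux_adj _ hG a b)
    set c : (Fin n → ℝ) → Fin k → ℝ := fun x =>
      Matrix.mulVec (J x * (J x).transpose)⁻¹ (Matrix.mulVec (J x) (ω x)) with hc
    have hcs : ∀ a, ContDiffOn ℝ (⊤ : ℕ∞) (fun x => c x a) D := by
      intro a
      simp only [hc, Matrix.mulVec, dotProduct]
      exact ContDiffOn.sum fun b _ => (hGi a b).mul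
        (ContDiffOn.sum fun i _ => (hJs b i).mul (hωs i))
    set X : (Fin n → ℝ) → Fin n → ℝ := fun x => ω x - Matrix.mulVec (J x).transpose (c x) with hX
    have hXs : ContDiffOn ℝ (⊤ : ℕ∞) X D := by
      refine hω.sub (contDiffOn_pi.2 fun i => ?_)
      simp only [Matrix.mulVec, dotProduct, Matrix.transpose_apply]
      exact ContDiffOn.sum fun a _ => (hJs a i).mul (hcs a)
    have hJX : ∀ x ∈ D, Matrix.mulVec (J x) (X x) = 0 := by
      intro x hx
      simp only [hX, hc]
      rw [Matrix.mulVec_sub, Matrix.mulVec_mulVec, Matrix.mulVec_mulVec,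
        Matrix.mul_nonsing_inv _ (hunit x hx), Matrix.one_mulVec, sub_self]
    have hXω := h X hXs (by
      intro a x hx
      have := congrFun (hJX x hx) a
      simp only [Matrix.mulVec, dotProduct, hJ, Matrix.of_apply, Pi.zero_apply] at this
      simp only [vact]
      rw [← this]
      exact Finset.sum_congr rfl fun i _ => mul_comm _ _)
    refine ⟨fun a x => c x a, hcs, fun x hx i => ?_⟩
    have h0 : X x ⬝ᵥ X x = 0 := by
      have e1 : X x ⬝ᵥ ω x = 0 := hXω x hx
      have e2 : X x ⬝ᵥ Matrix.mulVec (J x).transpose (c x) = 0 := by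
        rw [Matrix.dotProduct_mulVec, Matrix.vecMul_transpose, hJX x hx, zero_dotProduct]
      calc X x ⬝ᵥ X x = X x ⬝ᵥ (ω x - Matrix.mulVec (J x).transpose (c x)) := rfl
        _ = 0 := by rw [dotProduct_sub, e1, e2, sub_zero]
    have h1 := congrFun (dotProduct_self_eq_zero.1 h0) i
    simp only [hX, Pi.sub_apply, Pi.zero_apply, sub_eq_zero] at h1
    rw [h1]
    simp only [Matrix.mulVec, dotProduct, Matrix.transpose_apply, hJ, Matrix.of_apply]
    exact Finset.sum_congr rfl fun i _ => mul_comm _ _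
  · rintro ⟨c, -, hc⟩ X - hT x hx
    calc ∑ i, X x i * ω x i = ∑ i, ∑ a, c a x * (X x i * pd (fun y => f y a) i x) := by
          refine Finset.sum_congr rfl fun i _ => ?_
          rw [hc x hx i, Finset.mul_sum]
          exact Finset.sum_congr rfl fun a _ => by ring
      _ = ∑ a, c a x * vact X (fun y => f y a) x := by
          rw [Finset.sum_comm]
          simp only [vact, Finset.mul_sum]
      _ = 0 := Finset.sum_eq_zero fun a _ => by rw [hT a x hx, mul_zero]
end
end

section
/- If X is a tangent vector field on D and ω = Σ_{a=1}^k ω_a df^a with smooth functions ω_a : D → ℝ, then the Lie derivative L_X ω, defined componentwise by (L_X ω)_i = Σ_{j=1}^n (X^j ∂_j ω_i + ω_j ∂_i X^j), equals Σ_{a=1}^k X(ω_a) df^a; in particular ⟨Y, L_X ω⟩ = 0 identically on D for every tangent vector field Y. -/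
open scoped BigOperators

noncomputable section

/-- Lie derivative of a 1-form along a vector field:
`(L_X ω)_i = Σ_j (Xʲ ∂_j ω_i + ω_j ∂_i Xʲ)`. -/
def lieDer {n : ℕ} (X ω : (Fin n → ℝ) → Fin n → ℝ) (x : Fin n → ℝ) : Fin n → ℝ :=
  fun i => ∑ j, (X x j * pd (fun y => ω y i) j x + ω x j * pd (fun y => X y j) i x)

lemma two_le_smooth : (2 : WithTop ℕ∞) ≤ ((⊤ : ℕ∞) : WithTop ℕ∞) :=
  WithTop.coe_le_coe.2 (le_top : (2 : ℕ∞) ≤ ⊤)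

lemma pd_congr_open {n : ℕ} {D : Set (Fin n → ℝ)} (hD : IsOpen D)
    {g h : (Fin n → ℝ) → ℝ} (e : ∀ y ∈ D, g y = h y) {x : Fin n → ℝ} (hx : x ∈ D)
    (i : Fin n) : pd g i x = pd h i x := by
  have : g =ᶠ[nhds x] h := Filter.eventually_of_mem (hD.mem_nhds hx) e
  unfold pd
  rw [this.fderiv_eq]

lemma pd_sum_mul {n : ℕ} {ι : Type} [Fintype ι] (u v : ι → (Fin n → ℝ) → ℝ)
    {x : Fin n → ℝ} (hu : ∀ a, DifferentiableAt ℝ (u a) x)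
    (hv : ∀ a, DifferentiableAt ℝ (v a) x) (i : Fin n) :
    pd (fun y => ∑ a, u a y * v a y) i x
      = ∑ a, (u a x * pd (v a) i x + v a x * pd (u a) i x) := by
  unfold pd
  rw [fderiv_fun_sum (fun a _ => (hu a).fun_mul (hv a))]
  simp only [ContinuousLinearMap.sum_apply]
  refine Finset.sum_congr rfl fun a _ => ?_
  rw [fderiv_fun_mul (hu a) (hv a)]
  simp

lemma pd_differentiableAt {n : ℕ} {g : (Fin n → ℝ) → ℝ} {x : Fin n → ℝ}
    (hg : ContDiffAt ℝ (⊤ : ℕ∞) g x) (i : Fin n) : DifferentiableAt ℝ (pd g i) x := by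
  have h1 : DifferentiableAt ℝ (fderiv ℝ g) x :=
    (hg.fderiv_right (m := 1) (by rw [one_add_one_eq_two]; exact two_le_smooth)).differentiableAt (by simp)
  exact h1.clm_apply (differentiableAt_const _)

lemma pd_pd_comm {n : ℕ} {g : (Fin n → ℝ) → ℝ} {x : Fin n → ℝ}
    (hg : ContDiffAt ℝ (⊤ : ℕ∞) g x) (i j : Fin n) : pd (pd g i) j x = pd (pd g j) i x := by
  have h1 : DifferentiableAt ℝ (fderiv ℝ g) x :=
    (hg.fderiv_right (m := 1) (by rw [one_add_one_eq_two]; exact two_le_smooth)).differentiableAt (by simp)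
  have key : ∀ i j : Fin n, pd (pd g i) j x
      = fderiv ℝ (fderiv ℝ g) x (Pi.single j 1) (Pi.single i 1) := by
    intro i j
    have : pd g i = fun y => fderiv ℝ g y (Pi.single i 1) := rfl
    rw [this]
    unfold pd
    rw [fderiv_clm_apply h1 (differentiableAt_const _)]
    simp
  rw [key, key]
  have hs : IsSymmSndFDerivAt ℝ g x := hg.isSymmSndFDerivAt (by
    simp only [minSmoothness_of_isRCLikeNormedField]
    exact two_le_smooth)
  exact hs _ _

/-- If `X` is a (smooth) tangent vector field and `ω = Σ_a ω_a dfᵃ` on `D`,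
then `L_X ω = Σ_a X(ω_a) dfᵃ` on `D`; in particular `⟨Y, L_X ω⟩ = 0` on `D`
for every tangent vector field `Y`. -/
theorem statement5 {n k : ℕ} (hk : 0 < k) (hkn : k < n)
    (D : Set (Fin n → ℝ)) (hD : IsOpen D)
    (f : (Fin n → ℝ) → Fin k → ℝ) (hf : ContDiffOn ℝ (⊤ : ℕ∞) f D)
    (X : (Fin n → ℝ) → Fin n → ℝ) (hX : ContDiffOn ℝ (⊤ : ℕ∞) X D)
    (hXt : ∀ a, ∀ x ∈ D, vact X (fun y => f y a) x = 0)
    (c : Fin k → (Fin n → ℝ) → ℝ) (hc : ∀ a, ContDiffOn ℝ (⊤ : ℕ∞) (c a) D)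
    (ω : (Fin n → ℝ) → Fin n → ℝ)
    (hωdef : ∀ x ∈ D, ∀ i, ω x i = ∑ a, c a x * pd (fun y => f y a) i x) :
    (∀ x ∈ D, ∀ i,
      lieDer X ω x i = ∑ a, vact X (c a) x * pd (fun y => f y a) i x) ∧
    (∀ Y : (Fin n → ℝ) → Fin n → ℝ, ContDiffOn ℝ (⊤ : ℕ∞) Y D →
      (∀ a, ∀ x ∈ D, vact Y (fun y => f y a) x = 0) →
      ∀ x ∈ D, ∑ i, Y x i * lieDer X ω x i = 0) := by
  have main : ∀ x ∈ D, ∀ i,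
      lieDer X ω x i = ∑ a, vact X (c a) x * pd (fun y => f y a) i x := by
    intro x hx i
    have hfa : ∀ a, ContDiffAt ℝ (⊤ : ℕ∞) (fun y => f y a) x := fun a =>
      contDiffAt_pi.1 (hf.contDiffAt (hD.mem_nhds hx)) a
    have hXj : ∀ j, DifferentiableAt ℝ (fun y => X y j) x := fun j =>
      (contDiffAt_pi.1 (hX.contDiffAt (hD.mem_nhds hx)) j).differentiableAt (by simp)
    have hca : ∀ a, DifferentiableAt ℝ (c a) x := fun a =>
      ((hc a).contDiffAt (hD.mem_nhds hx)).differentiableAt (by simp)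
    have h0 : ∀ a, ∑ j, (X x j * pd (pd (fun y => f y a) i) j x
        + pd (fun y => f y a) j x * pd (fun y => X y j) i x) = 0 := by
      intro a
      have h1 := pd_sum_mul (fun j y => X y j) (fun j => pd (fun y => f y a) j) hXj
        (fun j => pd_differentiableAt (hfa a) j) i
      have h2 := pd_congr_open (h := fun _ => 0) hD (hXt a) hx i
      have h3 : pd (fun _ : Fin n → ℝ => (0 : ℝ)) i x = 0 := by simp [pd]
      rw [h3] at h2
      have h4 := h1.symm.trans h2
      rw [← h4]
      refine Finset.sum_congr rfl fun j _ => ?_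
      rw [pd_pd_comm (hfa a) i j]
    have hω : ∀ j, pd (fun y => ω y i) j x = ∑ a, (c a x * pd (pd (fun y => f y a) i) j x
        + pd (fun y => f y a) i x * pd (c a) j x) := by
      intro j
      rw [pd_congr_open hD (fun y hy => hωdef y hy i) hx j]
      exact pd_sum_mul c (fun a => pd (fun y => f y a) i) hca
        (fun a => pd_differentiableAt (hfa a) i) j
    have e : ∀ j, X x j * pd (fun y => ω y i) j x + ω x j * pd (fun y => X y j) i x
        = ∑ a, (X x j * pd (c a) j x * pd (fun y => f y a) i x
          + c a x * (X x j * pd (pd (fun y => f y a) i) j x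
        + pd (fun y => f y a) j x * pd (fun y => X y j) i x)) := by
      intro j
      rw [hω, hωdef x hx, Finset.mul_sum, Finset.sum_mul, ← Finset.sum_add_distrib]
      exact Finset.sum_congr rfl fun a _ => by ring
    unfold lieDer
    simp only [e]
    rw [Finset.sum_comm]
    refine Finset.sum_congr rfl fun a _ => ?_
    rw [Finset.sum_add_distrib, ← Finset.mul_sum, h0 a, ← Finset.sum_mul]
    simp [vact]
  refine ⟨main, fun Y _ hYt x hx => ?_⟩
  simp only [main x hx, Finset.mul_sum]
  rw [Finset.sum_comm]
  refine Finset.sum_eq_zero fun a _ => ?_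
  have := hYt a x hx
  unfold vact at this
  calc _ = vact X (c a) x * ∑ i, Y x i * pd (fun y => f y a) i x := by
        rw [Finset.mul_sum]
        exact Finset.sum_congr rfl fun i _ => by ring
    _ = 0 := by rw [this, mul_zero]
end
end

section
/- If Z is a Killing vector field of g on D that is also tangent, then: (i) Z(E^{ab}) = 0 identically on D for all a, b = 1, …, k (where E^{ab} is regarded as a smooth function on D); and (ii) [Z, N_⊥^a] = 0 identically on D for every a. -/
open scoped BigOperators

noncomputable section

/-- `g(X,Y) = Σ_{i,j} g_{ij} Xⁱ Yʲ`. -/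
def gpair {n : ℕ} (g : (Fin n → ℝ) → Fin n → Fin n → ℝ)
    (X Y : (Fin n → ℝ) → Fin n → ℝ) (x : Fin n → ℝ) : ℝ :=
  ∑ i, ∑ j, g x i j * X x i * Y x j

/-- The components `g^{ij}` of the inverse metric. -/
def ginv {n : ℕ} (g : (Fin n → ℝ) → Fin n → Fin n → ℝ) (x : Fin n → ℝ)
    (i j : Fin n) : ℝ :=
  (Matrix.of (g x))⁻¹ i j

/-- `f^{a i} = Σ_j g^{ij} ∂_j f^a`. -/
def fup {n k : ℕ} (g : (Fin n → ℝ) → Fin n → Fin n → ℝ)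
    (f : (Fin n → ℝ) → Fin k → ℝ) (a : Fin k) (i : Fin n) (x : Fin n → ℝ) : ℝ :=
  ∑ j, ginv g x i j * pd (fun y => f y a) j x

/-- `E^{ab} = Σ_i f^{a i} ∂_i f^b`. -/
def Emat {n k : ℕ} (g : (Fin n → ℝ) → Fin n → Fin n → ℝ)
    (f : (Fin n → ℝ) → Fin k → ℝ) (x : Fin n → ℝ) : Fin k → Fin k → ℝ :=
  fun a b => ∑ i, fup g f a i x * pd (fun y => f y b) i x

/-- `K = E⁻¹`. -/
def Kmat {n k : ℕ} (g : (Fin n → ℝ) → Fin n → Fin n → ℝ)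
    (f : (Fin n → ℝ) → Fin k → ℝ) (x : Fin n → ℝ) : Fin k → Fin k → ℝ :=
  fun a b => (Matrix.of (Emat g f x))⁻¹ a b

/-- The normal vector fields `(N_⊥^a)^i = Σ_b K^{ab} f^{b i}`. -/
def Nperp {n k : ℕ} (g : (Fin n → ℝ) → Fin n → Fin n → ℝ)
    (f : (Fin n → ℝ) → Fin k → ℝ) (a : Fin k) (x : Fin n → ℝ) : Fin n → ℝ :=
  fun i => ∑ b, Kmat g f x a b * fup g f b i x

/-- The normal projection `X_⊥ = Σ_a X(f^a) N_⊥^a` of a vector field. -/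
def perpPart {n k : ℕ} (g : (Fin n → ℝ) → Fin n → Fin n → ℝ)
    (f : (Fin n → ℝ) → Fin k → ℝ) (X : (Fin n → ℝ) → Fin n → ℝ)
    (x : Fin n → ℝ) : Fin n → ℝ :=
  fun i => ∑ a, vact X (fun y => f y a) x * Nperp g f a x i

/-- The tangential projection `X_t = X − X_⊥` of a vector field. -/
def tangPart {n k : ℕ} (g : (Fin n → ℝ) → Fin n → Fin n → ℝ)
    (f : (Fin n → ℝ) → Fin k → ℝ) (X : (Fin n → ℝ) → Fin n → ℝ)
    (x : Fin n → ℝ) : Fin n → ℝ :=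
  fun i => X x i - perpPart g f X x i

/-- `Z` is a Killing vector field of `g` on `D`:
`Z(g(X,Y)) = g([Z,X],Y) + g(X,[Z,Y])` for all smooth vector fields `X, Y`. -/
def IsKilling {n : ℕ} (D : Set (Fin n → ℝ))
    (g : (Fin n → ℝ) → Fin n → Fin n → ℝ)
    (Z : (Fin n → ℝ) → Fin n → ℝ) : Prop :=
  ∀ X Y : (Fin n → ℝ) → Fin n → ℝ, ContDiffOn ℝ (⊤ : ℕ∞) X D → ContDiffOn ℝ (⊤ : ℕ∞) Y D →
    ∀ x ∈ D, vact Z (fun y => gpair g X Y y) x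
      = gpair g (lie Z X) Y x + gpair g X (lie Z Y) x

theorem vact_eq {n : ℕ} (X : (Fin n → ℝ) → Fin n → ℝ) (h : (Fin n → ℝ) → ℝ)
    (x : Fin n → ℝ) : vact X h x = fderiv ℝ h x (X x) := by
  have h1 : X x = ∑ i, X x i • (Pi.single i (1 : ℝ) : Fin n → ℝ) := by
    ext j
    simp [Finset.sum_apply, Pi.single_apply]
  conv_rhs => rw [h1]
  simp [vact, pd, map_sum]

theorem lie_eq {n : ℕ} (X Y : (Fin n → ℝ) → Fin n → ℝ) (x : Fin n → ℝ) (j : Fin n) :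
    lie X Y x j = fderiv ℝ (fun y => Y y j) x (X x) - fderiv ℝ (fun y => X y j) x (Y x) := by
  rw [← vact_eq, ← vact_eq]
  simp [lie, vact, Finset.sum_sub_distrib]

theorem det_smooth {n m : ℕ} {D : Set (Fin n → ℝ)}
    (M : (Fin n → ℝ) → Matrix (Fin m) (Fin m) ℝ)
    (hM : ∀ i j, ContDiffOn ℝ (⊤ : ℕ∞) (fun y => M y i j) D) :
    ContDiffOn ℝ (⊤ : ℕ∞) (fun y => (M y).det) D := by
  simp only [Matrix.det_apply]
  refine ContDiffOn.sum fun σ _ => ?_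
  refine ContDiffOn.const_smul _ ?_
  exact contDiffOn_prod fun i _ => hM _ _

theorem inv_smooth {n m : ℕ} {D : Set (Fin n → ℝ)}
    (M : (Fin n → ℝ) → Matrix (Fin m) (Fin m) ℝ)
    (hM : ∀ i j, ContDiffOn ℝ (⊤ : ℕ∞) (fun y => M y i j) D)
    (hu : ∀ x ∈ D, IsUnit (M x)) (i j : Fin m) :
    ContDiffOn ℝ (⊤ : ℕ∞) (fun y => (M y)⁻¹ i j) D := by
  have h1 : (fun y => (M y)⁻¹ i j) = fun y => ((M y).det)⁻¹ * (M y).adjugate i j := by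
    funext y
    simp [Matrix.inv_def, Ring.inverse_eq_inv']
  rw [h1]
  refine ContDiffOn.mul (ContDiffOn.inv (det_smooth M hM) fun x hx => ?_) ?_
  · exact ((Matrix.isUnit_iff_isUnit_det _).1 (hu x hx)).ne_zero
  · simp only [Matrix.adjugate_apply]
    refine det_smooth _ fun a b => ?_
    by_cases hab : a = j
    · subst hab
      simp only [Matrix.updateRow_self]
      exact contDiffOn_const
    · simp only [Matrix.updateRow_ne hab]
      exact hM a b

theorem pd_smooth {n : ℕ} {D : Set (Fin n → ℝ)} (hD : IsOpen D) (h : (Fin n → ℝ) → ℝ)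
    (hh : ContDiffOn ℝ (⊤ : ℕ∞) h D) (i : Fin n) : ContDiffOn ℝ (⊤ : ℕ∞) (pd h i) D := by
  have h1 : ContDiffOn ℝ (⊤ : ℕ∞) (fderiv ℝ h) D := hh.fderiv_of_isOpen hD (by exact le_rfl)
  exact h1.clm_apply contDiffOn_const

theorem gpair_fup {n k : ℕ} {D : Set (Fin n → ℝ)}
    (f : (Fin n → ℝ) → Fin k → ℝ) (g : (Fin n → ℝ) → Fin n → Fin n → ℝ)
    (hgsym : ∀ x ∈ D, ∀ i j, g x i j = g x j i)
    (hginv : ∀ x ∈ D, IsUnit (Matrix.of (g x))) (a : Fin k)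
    (Y : (Fin n → ℝ) → Fin n → ℝ) (x : Fin n → ℝ) (hx : x ∈ D) :
    gpair g (fun y i => fup g f a i y) Y x = vact Y (fun y => f y a) x := by
  have hm : Matrix.of (g x) * (Matrix.of (g x))⁻¹ = 1 :=
    Matrix.mul_nonsing_inv _ ((Matrix.isUnit_iff_isUnit_det _).1 (hginv x hx))
  have key : ∀ j, ∑ i, g x i j * fup g f a i x = pd (fun y => f y a) j x := by
    intro j
    have h2 : (fun i => fup g f a i x) =
        (Matrix.of (g x))⁻¹.mulVec (fun l => pd (fun y => f y a) l x) := by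
      funext i
      simp [fup, ginv, Matrix.mulVec, dotProduct]
    have h3 : (Matrix.of (g x)).mulVec (fun i => fup g f a i x) =
        fun l => pd (fun y => f y a) l x := by
      rw [h2, Matrix.mulVec_mulVec, hm, Matrix.one_mulVec]
    have h4 := congrFun h3 j
    simp only [Matrix.mulVec, dotProduct, Matrix.of_apply] at h4
    rw [← h4]
    exact Finset.sum_congr rfl fun i _ => by rw [hgsym x hx i j]
  unfold gpair vact
  rw [Finset.sum_comm]
  refine Finset.sum_congr rfl fun j _ => ?_
  rw [← key j, Finset.mul_sum]
  exact Finset.sum_congr rfl fun i _ => by ring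

/-- If `Z` is a tangent Killing vector field of `g` on `D`, then
(i) `Z(E^{ab}) = 0` on `D` for all `a, b`, and (ii) `[Z, N_⊥^a] = 0` on `D`
for every `a`. -/
theorem statement11 {n k : ℕ} (hk : 0 < k) (hkn : k < n)
    (D : Set (Fin n → ℝ)) (hD : IsOpen D)
    (f : (Fin n → ℝ) → Fin k → ℝ) (hf : ContDiffOn ℝ (⊤ : ℕ∞) f D)
    (hrank : ∀ x ∈ D,
      (Matrix.of fun (a : Fin k) (i : Fin n) => pd (fun y => f y a) i x).rank = k)
    (g : (Fin n → ℝ) → Fin n → Fin n → ℝ) (hg : ContDiffOn ℝ (⊤ : ℕ∞) g D)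
    (hgsym : ∀ x ∈ D, ∀ i j, g x i j = g x j i)
    (hginv : ∀ x ∈ D, IsUnit (Matrix.of (g x)))
    (hE : ∀ x ∈ D, IsUnit (Matrix.of (Emat g f x)))
    (Z : (Fin n → ℝ) → Fin n → ℝ) (hZ : ContDiffOn ℝ (⊤ : ℕ∞) Z D)
    (hZK : IsKilling D g Z)
    (hZt : ∀ a, ∀ x ∈ D, vact Z (fun y => f y a) x = 0) :
    (∀ a b, ∀ x ∈ D, vact Z (fun y => Emat g f y a b) x = 0) ∧
    (∀ a, ∀ x ∈ D, ∀ i, lie Z (Nperp g f a) x i = 0) := by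
  have hfa : ∀ a, ContDiffOn ℝ (⊤ : ℕ∞) (fun y => f y a) D := fun a => contDiffOn_pi.1 hf a
  have hgij : ∀ i j, ContDiffOn ℝ (⊤ : ℕ∞) (fun y => g y i j) D := fun i j =>
    contDiffOn_pi.1 (contDiffOn_pi.1 hg i) j
  have hfup : ∀ a i, ContDiffOn ℝ (⊤ : ℕ∞) (fun y => fup g f a i y) D := by
    intro a i
    unfold fup ginv
    refine ContDiffOn.sum fun j _ => ContDiffOn.mul ?_ (pd_smooth hD _ (hfa a) j)
    exact inv_smooth (fun y => Matrix.of (g y)) hgij hginv i j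
  have hF : ∀ a, ContDiffOn ℝ (⊤ : ℕ∞) (fun y i => fup g f a i y) D := fun a =>
    contDiffOn_pi.2 fun i => hfup a i
  have hEs : ∀ a b, ContDiffOn ℝ (⊤ : ℕ∞) (fun y => Emat g f y a b) D := by
    intro a b
    unfold Emat
    exact ContDiffOn.sum fun i _ => (hfup a i).mul (pd_smooth hD _ (hfa b) i)
  have hKs : ∀ a b, ContDiffOn ℝ (⊤ : ℕ∞) (fun y => Kmat g f y a b) D := by
    intro a b
    exact inv_smooth (fun y => Matrix.of (Emat g f y)) hEs hE a b
  have hd : ∀ (h : (Fin n → ℝ) → ℝ), ContDiffOn ℝ (⊤ : ℕ∞) h D → ∀ x ∈ D,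
      DifferentiableAt ℝ h x := fun h hh x hx =>
    (hh.contDiffAt (hD.mem_nhds hx)).differentiableAt (by simp)
  -- the gradient fields commute with `Z`
  have hlie : ∀ a, ∀ x ∈ D, lie Z (fun y i => fup g f a i y) x = 0 := by
    intro a x hx
    have hnx := hD.mem_nhds hx
    have hpair : ∀ j, gpair g (lie Z (fun y i => fup g f a i y))
        (fun _ => Pi.single j 1) x = 0 := by
      intro j
      have hK := hZK (fun y i => fup g f a i y) (fun _ => Pi.single j 1) (hF a)
        contDiffOn_const x hx
      rw [gpair_fup f g hgsym hginv a _ x hx, vact_eq, vact_eq] at hK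
      have hev : (fun y => gpair g (fun y i => fup g f a i y) (fun _ => Pi.single j 1) y)
          =ᶠ[nhds x] fun y => fderiv ℝ (fun y => f y a) y (Pi.single j 1) := by
        filter_upwards [hnx] with y hy
        rw [gpair_fup f g hgsym hginv a _ y hy, vact_eq]
      have hdf : DifferentiableAt ℝ (fderiv ℝ (fun y => f y a)) x :=
        ((((hfa a).fderiv_of_isOpen (m := (⊤ : ℕ∞)) hD (by exact le_rfl)).contDiffAt
          hnx).differentiableAt (by simp))
      have hdZ : DifferentiableAt ℝ Z x := (hZ.contDiffAt hnx).differentiableAt (by simp)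
      rw [hev.fderiv_eq, fderiv_clm_apply hdf (differentiableAt_const _)] at hK
      have hev2 : (fun y => fderiv ℝ (fun y => f y a) y (Z y)) =ᶠ[nhds x] fun _ => (0 : ℝ) := by
        filter_upwards [hnx] with y hy
        rw [← vact_eq, hZt a y hy]
      have h0 := hev2.fderiv_eq (𝕜 := ℝ)
      rw [fderiv_clm_apply hdf hdZ] at h0
      have h0j := congrArg (fun T : (Fin n → ℝ) →L[ℝ] ℝ => T (Pi.single j (1 : ℝ))) h0
      have hsym := ((hfa a).contDiffAt hnx).isSymmSndFDerivAt (by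
        simp only [minSmoothness_of_isRCLikeNormedField]
        exact WithTop.coe_le_coe.2 (le_top : (2 : ℕ∞) ≤ ⊤))
      have hs := hsym (Z x) (Pi.single j 1)
      have hlz : lie Z (fun _ => Pi.single j 1) x = -(fderiv ℝ Z x (Pi.single j 1)) := by
        funext l
        rw [lie_eq]
        have : fderiv ℝ (fun y => Z y l) x (Pi.single j 1) = fderiv ℝ Z x (Pi.single j 1) l := by
          rw [fderiv_pi (differentiableAt_pi.1 hdZ)]
          rfl
        simp [this]
      rw [hlz] at hK
      simp at hK h0j
      linarith
    have hdet := (Matrix.isUnit_iff_isUnit_det _).1 (hginv x hx)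
    have hv : Matrix.vecMul (lie Z (fun y i => fup g f a i y) x) (Matrix.of (g x)) = 0 := by
      funext j
      refine Eq.trans ?_ (hpair j)
      simp [gpair, Matrix.vecMul, dotProduct, Pi.single_apply, mul_comm]
    have h5 := congrArg (fun v => Matrix.vecMul v (Matrix.of (g x))⁻¹) hv
    simpa [Matrix.vecMul_vecMul, Matrix.mul_nonsing_inv _ hdet] using h5
  have hZE : ∀ a b, ∀ x ∈ D, vact Z (fun y => Emat g f y a b) x = 0 := by
    intro a b x hx
    have hK := hZK _ _ (hF b) (hF a) x hx
    have hev : (fun y => gpair g (fun y i => fup g f b i y) (fun y i => fup g f a i y) y)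
        =ᶠ[nhds x] fun y => Emat g f y a b := by
      filter_upwards [hD.mem_nhds hx] with y hy
      rw [gpair_fup f g hgsym hginv b _ y hy]
      rfl
    rw [vact_eq, hev.fderiv_eq, ← vact_eq] at hK
    rw [hK]
    simp [gpair, hlie a x hx, hlie b x hx]
  refine ⟨hZE, ?_⟩
  have hKE : ∀ y ∈ D, Matrix.of (Kmat g f y) * Matrix.of (Emat g f y) = 1 := fun y hy =>
    Matrix.nonsing_inv_mul _ ((Matrix.isUnit_iff_isUnit_det _).1 (hE y hy))
  have hZKm : ∀ a b, ∀ x ∈ D, fderiv ℝ (fun y => Kmat g f y a b) x (Z x) = 0 := by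
    intro a b x hx
    have hv : Matrix.vecMul (fun b => fderiv ℝ (fun y => Kmat g f y a b) x (Z x))
        (Matrix.of (Emat g f x)) = 0 := by
      funext c
      have hev : (fun y => ∑ b, Kmat g f y a b * Emat g f y b c) =ᶠ[nhds x]
          fun _ => (1 : Matrix (Fin k) (Fin k) ℝ) a c := by
        filter_upwards [hD.mem_nhds hx] with y hy
        rw [← hKE y hy]
        rfl
      have h1 := congrArg (fun T : (Fin n → ℝ) →L[ℝ] ℝ => T (Z x)) hev.fderiv_eq
      rw [fderiv_fun_sum (fun b _ => (hd _ (hKs a b) x hx).fun_mul (hd _ (hEs b c) x hx))] at h1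
      simp only [fderiv_fun_mul (hd _ (hKs a _) x hx) (hd _ (hEs _ c) x hx)] at h1
      have hz : ∀ b, fderiv ℝ (fun y => Emat g f y b c) x (Z x) = 0 := fun b => by
        rw [← vact_eq, hZE b c x hx]
      simp [hz] at h1
      simp only [Matrix.vecMul, dotProduct, Matrix.of_apply, Pi.zero_apply]
      rw [← h1]
      exact Finset.sum_congr rfl fun i _ => mul_comm _ _
    have hdet := (Matrix.isUnit_iff_isUnit_det _).1 (hE x hx)
    have h5 := congrArg (fun v => Matrix.vecMul v (Matrix.of (Emat g f x))⁻¹) hv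
    simp only [Matrix.vecMul_vecMul, Matrix.mul_nonsing_inv _ hdet, Matrix.vecMul_one,
      Matrix.zero_vecMul] at h5
    exact congrFun h5 b
  intro a x hx i
  rw [lie_eq]
  have hN : Nperp g f a x = ∑ b, Kmat g f x a b • (fun i => fup g f b i x) := by
    funext l
    simp [Nperp, Finset.sum_apply]
  rw [hN]
  unfold Nperp
  rw [fderiv_fun_sum (fun b _ => (hd _ (hKs a b) x hx).fun_mul (hd _ (hfup b i) x hx))]
  simp only [fderiv_fun_mul (hd _ (hKs a _) x hx) (hd _ (hfup _ i) x hx)]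
  have hl : ∀ b, fderiv ℝ (fun y => fup g f b i y) x (Z x) =
      fderiv ℝ (fun y => Z y i) x (fun i => fup g f b i x) := by
    intro b
    have := congrFun (hlie b x hx) i
    rw [lie_eq] at this
    exact sub_eq_zero.1 this
  simp [hZKm a _ x hx, hl]
end
end
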